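/- arXiv:1811.07327 — 2 statements merged into one kernel-verified Lean document; each statement's English description precedes it below -/
import Mathlib

section
/- Let G be a graph and k ≥ 2, let ℓ: V(G) → {0,…,k−1}. There exists an edge set F that is the union of k matchings with d_F(v) ≥ ℓ(v) for every vertex v (an ℓ-bounded matching-k-cover) if and only if for every X ⊆ V(G), the sum over x ∈ V(G)∖X of max(ℓ(x) − d_{G−X}(x), 0) is at most k·|X|. -/
/-- `M` is a matching of `G`: a set of edges of `G` that are pairwise vertex-disjoint. -/
def IsMatching {V : Type*} (G : SimpleGraph V) (M : Finset (Sym2 V)) : Prop :=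
  ↑M ⊆ G.edgeSet ∧ (M : Set (Sym2 V)).Pairwise fun e f => ∀ v : V, ¬(v ∈ e ∧ v ∈ f)

/-- A vertex `v` is covered by an edge set `F` if some edge of `F` is incident to it. -/
def Covers {V : Type*} (F : Finset (Sym2 V)) (v : V) : Prop := ∃ e ∈ F, v ∈ e

instance {V : Type*} [DecidableEq V] (F : Finset (Sym2 V)) (v : V) : Decidable (Covers F v) :=
  inferInstanceAs (Decidable (∃ e ∈ F, v ∈ e))

/-- A stable (independent) set of vertices. -/
def IsStable {V : Type*} (G : SimpleGraph V) (S : Finset V) : Prop :=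
  ∀ u ∈ S, ∀ v ∈ S, ¬ G.Adj u v

/-- The external neighborhood `N(S)`. -/
def nbr {V : Type*} [Fintype V] [DecidableEq V] (G : SimpleGraph V) [DecidableRel G.Adj]
    (S : Finset V) : Finset V :=
  Finset.univ.filter fun w => w ∉ S ∧ ∃ u ∈ S, G.Adj u w

/-- degree of a vertex in an edge set -/
def degF {V : Type*} [DecidableEq V] (F : Finset (Sym2 V)) (v : V) : ℕ :=
  (F.filter fun e => v ∈ e).card

open Finset

section EdgeSets

variable {V : Type*} [DecidableEq V]

theorem degF_insert {F : Finset (Sym2 V)} {e : Sym2 V} (he : e ∉ F) (v : V) :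
    degF (insert e F) v = degF F v + if v ∈ e then 1 else 0 := by
  unfold degF
  rw [filter_insert]
  split_ifs with h
  · rw [card_insert_of_notMem (by simp [he])]
  · rfl

theorem degF_erase {F : Finset (Sym2 V)} {e : Sym2 V} (he : e ∈ F) (v : V) :
    degF (F.erase e) v + (if v ∈ e then 1 else 0) = degF F v := by
  conv_rhs => rw [← insert_erase he, degF_insert (notMem_erase e F)]

theorem degF_eq_card_neighbors [Fintype V] (F : Finset (Sym2 V)) (v : V) :
    degF F v = #{w | s(v, w) ∈ F} := by
  symm
  refine card_bij (fun w _ => s(v, w)) ?_ ?_ ?_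
  · intro w hw
    simpa using hw
  · intro a _ b _ h
    exact Sym2.congr_right.1 h
  · intro e he
    obtain ⟨he, hv⟩ := mem_filter.1 he
    obtain ⟨w, rfl⟩ := hv
    exact ⟨w, by simpa using he, rfl⟩

theorem sum_card_edges_comm (F : Finset (Sym2 V)) (S T : Finset V) :
    ∑ x ∈ S, #{y ∈ T | s(x, y) ∈ F} = ∑ y ∈ T, #{x ∈ S | s(y, x) ∈ F} := by
  have := sum_card_bipartiteAbove_eq_sum_card_bipartiteBelow (s := S) (t := T)
    (fun x y => s(x, y) ∈ F)
  simp only [bipartiteAbove, bipartiteBelow] at this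
  rw [this]
  simp only [Sym2.eq_swap]

end EdgeSets

section DegreeConstrained

variable {V : Type*} [DecidableEq V]

/-- `F` is a set of edges of `G` with at most `k` edges at every vertex. -/
def IsFeasible (G : SimpleGraph V) (k : ℕ) (F : Finset (Sym2 V)) : Prop :=
  ↑F ⊆ G.edgeSet ∧ ∀ v, degF F v ≤ k

/-- The total amount by which the degrees in `F` fall short of `ℓ`. -/
def deficiency [Fintype V] (ℓ : V → ℕ) (F : Finset (Sym2 V)) : ℕ := ∑ v, (ℓ v - degF F v)

/-- A feasible edge set of least deficiency. -/
def IsOptimal [Fintype V] (G : SimpleGraph V) (k : ℕ) (ℓ : V → ℕ) (F : Finset (Sym2 V)) : Prop :=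
  IsFeasible G k F ∧ ∀ F', IsFeasible G k F' → deficiency ℓ F ≤ deficiency ℓ F'

/-- The first `n` steps of `p` are edges of `G`, alternately outside and inside `F`. -/
def IsAlternating (G : SimpleGraph V) (F : Finset (Sym2 V)) (p : ℕ → V) (n : ℕ) : Prop :=
  ∀ i < n, G.Adj (p i) (p (i + 1)) ∧ (s(p i, p (i + 1)) ∈ F ↔ i % 2 = 1)

theorem IsOptimal.not_improvable [Fintype V] {G : SimpleGraph V} {k : ℕ} {ℓ : V → ℕ}
    {F F' : Finset (Sym2 V)} (hF : IsOptimal G k ℓ F) (hF' : IsFeasible G k F')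
    (h : ∀ v, ℓ v - degF F' v ≤ ℓ v - degF F v) (v : V) :
    ℓ v - degF F v ≤ ℓ v - degF F' v := by
  by_contra hv
  exact absurd (hF.2 F' hF') (not_le.2 (sum_lt_sum (fun v _ => h v) ⟨v, mem_univ v, not_le.1 hv⟩))

theorem degF_exchange {F : Finset (Sym2 V)} {u v w : V}
    (huv : s(u, v) ∉ F) (hvw : s(v, w) ∈ F) (x : V) :
    degF ((insert s(u, v) F).erase s(v, w)) x + (if x = v ∨ x = w then 1 else 0) =
      degF F x + (if x = u ∨ x = v then 1 else 0) := by
  have h₁ := degF_erase (mem_insert_of_mem (b := s(u, v)) hvw) x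
  rw [degF_insert huv] at h₁
  simpa using h₁

theorem IsOptimal.end_of_isAlternating [Fintype V] {G : SimpleGraph V} {k : ℕ} {ℓ : V → ℕ}
    (hℓ : ∀ v, ℓ v < k) (n : ℕ) {F : Finset (Sym2 V)} (hF : IsOptimal G k ℓ F) {p : ℕ → V}
    (h0 : degF F (p 0) < ℓ (p 0)) (hp : IsAlternating G F p n) :
    (n % 2 = 0 → degF F (p n) ≤ ℓ (p n)) ∧ (n % 2 = 1 → degF F (p n) = k) := by
  induction n using Nat.strong_induction_on generalizing F p with
  | _ n ih =>
  have prefix_end (j) (hj : j < n) := ih j hj hF h0 fun i hi => hp i (hi.trans hj)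
  obtain rfl | rfl | hn : n = 0 ∨ n = 1 ∨ 2 ≤ n := by omega
  · exact ⟨fun _ => h0.le, by simp⟩
  · refine ⟨by simp, fun _ => ?_⟩
    by_contra hk
    have hlt := lt_of_le_of_ne (hF.1.2 _) hk
    have he : s(p 0, p 1) ∉ F := by simpa using (hp 0 (by omega)).2
    have hadj : G.Adj (p 0) (p 1) := (hp 0 (by omega)).1
    have hdeg := degF_insert he
    have := hF.not_improvable (F' := insert s(p 0, p 1) F) ⟨?_, ?_⟩ ?_ (p 0)
    · simp only [hdeg] at this
      simp at this
      omega
    · intro e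
      simp only [coe_insert, Set.mem_insert_iff, mem_coe]
      rintro (rfl | h)
      · exact hadj
      · exact hF.1.1 h
    · intro v
      rw [hdeg]
      have := hF.1.2 v
      have := hℓ (p 0)
      simp only [Sym2.mem_iff]
      split_ifs with h
      · rcases h with rfl | rfl <;> omega
      · omega
    · intro v
      rw [hdeg]
      omega
  obtain ⟨hadj, he⟩ := hp 0 (by omega)
  obtain ⟨hadj', he'⟩ := hp 1 (by omega)
  simp only [zero_add, Nat.zero_mod, zero_ne_one, iff_false] at he hadj
  simp only [Nat.reduceAdd, Nat.one_mod, iff_true] at he' hadj'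
  have hk1 : degF F (p 1) = k := (prefix_end 1 (by omega)).2 rfl
  have hdeg := degF_exchange he he'
  set F' := (insert s(p 0, p 1) F).erase s(p 1, p 2) with hF'def
  have h01 := hadj.ne
  have h12 := hadj'.ne
  have hk0 := hℓ (p 0)
  have hfeas : IsFeasible G k F' := by
    constructor
    · intro e h
      simp only [hF'def, coe_erase, coe_insert, Set.mem_sdiff, Set.mem_insert_iff, mem_coe] at h
      rcases h.1 with rfl | h
      · exact hadj
      · exact hF.1.1 h
    · intro v
      have := hdeg v
      have := hF.1.2 v
      grind
  by_cases h2 : degF F (p 2) ≤ ℓ (p 2)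
  swap
  · exfalso
    have := hF.not_improvable hfeas (fun v => by have := hdeg v; grind) (p 0)
    have := hdeg (p 0)
    grind
  obtain rfl | hn : n = 2 ∨ 3 ≤ n := by omega
  · exact ⟨fun _ => h2, by simp⟩
  by_cases hA : ∃ j, 2 ≤ j ∧ j < n ∧ j % 2 = 0 ∧ p j = p 0
  · obtain ⟨j, hj2, hjn, hj, hpj⟩ := hA
    have := ih (n - j) (by omega) hF (p := fun i => p (i + j)) (by simpa [hpj] using h0)
      (fun i hi => by
        have := hp (i + j) (by omega)
        beta_reduce
        rw [show i + 1 + j = i + j + 1 by omega]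
        exact ⟨this.1, this.2.trans (by omega)⟩)
    simp only [Nat.sub_add_cancel hjn.le] at this
    exact ⟨fun h => this.1 (by omega), fun h => this.2 (by omega)⟩
  by_cases hB : ∃ j, 2 ≤ j ∧ j < n ∧ j % 2 = 1 ∧ p j = p 1
  · obtain ⟨j, hj2, hjn, hj, hpj⟩ := hB
    have := ih (n - (j - 1)) (by omega) hF
      (p := fun i => if i = 0 then p 0 else p (i + (j - 1))) (by simpa using h0)
      (fun i hi => by
        obtain rfl | hi0 := Nat.eq_zero_or_pos i
        · simp only [if_true, zero_add, one_ne_zero, if_false]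
          rw [show 1 + (j - 1) = j by omega, hpj]
          simpa using ⟨hadj, he⟩
        · have := hp (i + (j - 1)) (by omega)
          simp only [hi0.ne', if_false, Nat.add_eq_zero_iff, one_ne_zero, and_false]
          rw [show i + 1 + (j - 1) = i + (j - 1) + 1 by omega]
          exact ⟨this.1, this.2.trans (by omega)⟩)
    simp only [show n - (j - 1) ≠ 0 by omega, if_false,
      show n - (j - 1) + (j - 1) = n by omega] at this
    exact ⟨fun h => this.1 (by omega), fun h => this.2 (by omega)⟩
  push Not at hA hB
  have h02 : p 0 ≠ p 2 := fun h => he (by rw [h, Sym2.eq_swap]; exact he')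
  have hdef : deficiency ℓ F' = deficiency ℓ F := by
    have key (v) : (ℓ v - degF F' v) + (if v = p 0 then 1 else 0) =
        (ℓ v - degF F v) + (if v = p 2 then 1 else 0) := by
      have := hdeg v
      grind
    have := sum_congr (rfl : (univ : Finset V) = univ) fun v _ => key v
    simpa [sum_add_distrib, deficiency] using this
  have hopt : IsOptimal G k ℓ F' := ⟨hfeas, fun F'' h => hdef ▸ hF.2 F'' h⟩
  have hend := ih (n - 2) (by omega) hopt (p := fun i => p (i + 2))
    (by have := hdeg (p 2); simp only [zero_add]; grind)
    (fun i hi => by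
      have h := hp (i + 2) (by omega)
      have h₁ := prefix_end (i + 2) (by omega)
      have hA' := hA (i + 2) (by omega) (by omega)
      have hB' := hB (i + 2) (by omega) (by omega)
      have hk₁ := hℓ (p 1)
      beta_reduce
      rw [show i + 1 + 2 = i + 2 + 1 by omega]
      refine ⟨h.1, ?_⟩
      have hne₁ : i % 2 = 0 → s(p (i + 2), p (i + 2 + 1)) ≠ s(p 0, p 1) := by
        intro hi h
        rcases Sym2.eq_iff.1 h with ⟨h, -⟩ | ⟨h, -⟩ <;> grind
      have hne₂ : i % 2 = 1 → s(p (i + 2), p (i + 2 + 1)) ≠ s(p 1, p 2) := by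
        intro hi h
        have := hℓ (p 2)
        rcases Sym2.eq_iff.1 h with ⟨h, -⟩ | ⟨h, -⟩ <;> grind
      simp only [hF'def, mem_erase, mem_insert]
      grind)
  simp only [show n - 2 + 2 = n by omega] at hend
  have := hdeg (p n)
  have := hF.1.2 (p n)
  refine ⟨fun h => ?_, fun h => ?_⟩
  · have := hend.1 (by omega)
    grind
  · have := hend.2 (by omega)
    have := hℓ (p 0)
    grind

theorem exists_isOptimal [Fintype V] (G : SimpleGraph V) (k : ℕ) (ℓ : V → ℕ) :
    ∃ F, IsOptimal G k ℓ F := by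
  classical
  obtain ⟨F, hF, hmin⟩ := exists_min_image (univ.filter (IsFeasible G k)) (deficiency ℓ)
    ⟨∅, by simp [IsFeasible, degF]⟩
  exact ⟨F, by simpa using hF, by simpa using hmin⟩

/-- The degree-constrained subgraph theorem for lower bounds `ℓ` smaller than the upper bound
`k`. -/
theorem exists_degree_between [Fintype V] (G : SimpleGraph V) [DecidableRel G.Adj]
    (k : ℕ) (ℓ : V → ℕ) (hℓ : ∀ v, ℓ v < k)
    (h : ∀ X : Finset V,
      ∑ x ∈ Xᶜ, (ℓ x - #{y ∈ G.neighborFinset x | y ∉ X}) ≤ k * #X) :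
    ∃ F, IsFeasible G k F ∧ ∀ v, ℓ v ≤ degF F v := by
  classical
  obtain ⟨F, hF⟩ := exists_isOptimal G k ℓ
  refine ⟨F, hF.1, ?_⟩
  by_contra! hv
  obtain ⟨v, hv⟩ := hv
  let R (r : ℕ) : Finset V :=
    {u | ∃ n p, n % 2 = r ∧ p 0 = v ∧ IsAlternating G F p n ∧ p n = u}
  have hR0 (u) (hu : u ∈ R 0) : degF F u ≤ ℓ u := by
    obtain ⟨n, p, hn, rfl, hp, rfl⟩ := (mem_filter.1 hu).2
    exact (hF.end_of_isAlternating hℓ n hv hp).1 hn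
  have hR1 (u) (hu : u ∈ R 1) : degF F u = k := by
    obtain ⟨n, p, hn, rfl, hp, rfl⟩ := (mem_filter.1 hu).2
    exact (hF.end_of_isAlternating hℓ n hv hp).2 hn
  have hstep (r s : ℕ) (hr : r < 2) (hs : (r + 1) % 2 = s) (u w : V) (hu : u ∈ R r)
      (hadj : G.Adj u w) (hw : s(u, w) ∈ F ↔ r = 1) : w ∈ R s := by
    obtain ⟨n, p, hn, hpv, hp, hpu⟩ := (mem_filter.1 hu).2
    refine mem_filter.2 ⟨mem_univ _, n + 1, fun i => if i ≤ n then p i else w, by omega,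
      by simpa using hpv, fun i hi => ?_, by simp⟩
    obtain rfl | hin : i = n ∨ i < n := by omega
    · simpa [hpu, hn] using ⟨hadj, hw⟩
    · simpa [hin.le, Nat.succ_le_of_lt hin] using hp i hin
  have hv0 : v ∈ R 0 := mem_filter.2 ⟨mem_univ _, 0, fun _ => v, rfl, rfl, by
    intro i hi; omega, rfl⟩
  have hsub : R 0 ⊆ (R 1)ᶜ := fun u hu => mem_compl.2 fun hu' => by
    have := hR0 u hu
    have := hR1 u hu'
    have := hℓ u
    omega
  have hlow (x) (hx : x ∈ R 0) : #{y ∈ R 1 | s(x, y) ∈ F} + (ℓ x - degF F x) ≤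
      ℓ x - #{y ∈ G.neighborFinset x | y ∉ R 1} := by
    have h₁ : #{y ∈ G.neighborFinset x | y ∉ R 1} ≤ #{y | s(x, y) ∈ F ∧ y ∉ R 1} := by
      refine card_le_card fun y hy => ?_
      simp only [mem_filter, SimpleGraph.mem_neighborFinset, mem_univ, true_and] at hy ⊢
      refine ⟨?_, hy.2⟩
      by_contra hxy
      exact hy.2 (hstep 0 1 (by omega) rfl x y hx hy.1 (by simpa using hxy))
    have h₂ : #{y ∈ R 1 | s(x, y) ∈ F} + #{y | s(x, y) ∈ F ∧ y ∉ R 1} = degF F x := by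
      rw [degF_eq_card_neighbors,
        ← card_filter_add_card_filter_not (s := {w | s(x, w) ∈ F}) (· ∈ R 1)]
      congr 2 <;> ext y <;> simp [and_comm]
    have := hR0 x hx
    omega
  have hcount : ∑ x ∈ R 0, #{y ∈ R 1 | s(x, y) ∈ F} = k * #(R 1) := by
    rw [sum_card_edges_comm, mul_comm, ← smul_eq_mul]
    refine sum_const_nat fun y hy => ?_
    rw [← hR1 y hy, degF_eq_card_neighbors]
    congr 1
    ext x
    simp only [mem_filter, mem_univ, true_and, and_iff_right_iff_imp]
    exact fun hyx => hstep 1 0 (by omega) rfl y x hy (hF.1.1 hyx) (by simpa using hyx)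
  have := calc
    k * #(R 1) = ∑ x ∈ R 0, #{y ∈ R 1 | s(x, y) ∈ F} := hcount.symm
    _ < ∑ x ∈ R 0, (ℓ x - #{y ∈ G.neighborFinset x | y ∉ R 1}) :=
      sum_lt_sum (fun x hx => by have := hlow x hx; omega)
        ⟨v, hv0, by have := hlow v hv0; omega⟩
    _ ≤ ∑ x ∈ (R 1)ᶜ, (ℓ x - #{y ∈ G.neighborFinset x | y ∉ R 1}) :=
      sum_le_sum_of_subset hsub
    _ ≤ k * #(R 1) := h _
  exact lt_irrefl _ this

end DegreeConstrained

section EdgeColoring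

variable {V : Type*}

theorem SimpleGraph.Connected.card_le_two_of_degree_le_one {W : Type*} [Fintype W]
    {H : SimpleGraph W} [DecidableRel H.Adj] (hH : H.Connected) (hdeg : ∀ x, H.degree x ≤ 2)
    {S : Finset W} (hS : ∀ x ∈ S, H.degree x ≤ 1) : #S ≤ 2 := by
  classical
  have h₁ := hH.card_vert_le_card_edgeSet_add_one
  rw [Nat.card_eq_fintype_card, Nat.card_eq_fintype_card, ← SimpleGraph.edgeFinset_card] at h₁
  have h₂ := H.sum_degrees_eq_twice_card_edges
  have h₃ : ∑ x, (H.degree x + if x ∈ S then 1 else 0) ≤ ∑ _x : W, 2 :=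
    sum_le_sum fun x _ => by
      split_ifs with h
      · have := hS x h
        omega
      · exact hdeg x
  simp only [sum_add_distrib, sum_ite_mem, univ_inter, sum_const, smul_eq_mul, mul_one,
    card_univ] at h₃
  omega

/-- `c` colours the edges of `F` with colours from `P`, and distinct edges of `F` that share a
vertex get distinct colours. -/
def IsProperEdgeColoring (F : Finset (Sym2 V)) (P : Finset ℕ) (c : Sym2 V → ℕ) : Prop :=
  (∀ e ∈ F, c e ∈ P) ∧ ∀ e ∈ F, ∀ f ∈ F, ∀ v, v ∈ e → v ∈ f → c e = c f → e = f

/-- For each `u ∈ N`, the list `A u` consists of colours of `P` that do not appear at `u`. -/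
def IsFreeList (F : Finset (Sym2 V)) (P : Finset ℕ) (N : Finset V) (c : Sym2 V → ℕ)
    (A : V → Finset ℕ) : Prop :=
  ∀ u ∈ N, A u ⊆ P ∧ ∀ e ∈ F, u ∈ e → c e ∉ A u

/-- The graph formed by the edges of `F` coloured `a` or `b`. -/
def bichromaticGraph (F : Finset (Sym2 V)) (c : Sym2 V → ℕ) (a b : ℕ) : SimpleGraph V where
  Adj x y := x ≠ y ∧ s(x, y) ∈ F ∧ (c s(x, y) = a ∨ c s(x, y) = b)
  symm := ⟨fun x y h => by rwa [Sym2.eq_swap, ne_comm]⟩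
  loopless := ⟨fun x h => h.1 rfl⟩

open Classical in
/-- Exchange the colours `a` and `b` on the edges that meet `C`. -/
noncomputable def kempeColoring (C : Set V) (a b : ℕ) (c : Sym2 V → ℕ) (e : Sym2 V) : ℕ :=
  if ∃ x ∈ C, x ∈ e then Equiv.swap a b (c e) else c e

open Classical in
/-- Exchange the colours `a` and `b` in the lists of the vertices in `C`. -/
noncomputable def kempeList (C : Set V) (a b : ℕ) (A : V → Finset ℕ) (u : V) : Finset ℕ :=
  if u ∈ C then (A u).map (Equiv.swap a b).toEmbedding else A u

theorem card_kempeList (C : Set V) (a b : ℕ) (A : V → Finset ℕ) (u : V) :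
    #(kempeList C a b A u) = #(A u) := by
  unfold kempeList
  split_ifs <;> simp

theorem mem_kempeList_of_mem {C : Set V} {a b : ℕ} {A : V → Finset ℕ} {u : V} (hu : u ∈ C)
    (i : ℕ) : i ∈ kempeList C a b A u ↔ Equiv.swap a b i ∈ A u := by
  simp [kempeList, hu, mem_map_equiv]

theorem mem_kempeList_of_notMem {C : Set V} {a b : ℕ} {A : V → Finset ℕ} {u : V} (hu : u ∉ C)
    (i : ℕ) : i ∈ kempeList C a b A u ↔ i ∈ A u := by
  simp [kempeList, hu]

/-- `C` is a union of components of the subgraph of edges of `F` coloured `a` or `b`. -/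
def IsKempeClosed (F : Finset (Sym2 V)) (c : Sym2 V → ℕ) (a b : ℕ) (C : Set V) : Prop :=
  ∀ e ∈ F, c e = a ∨ c e = b → ∀ x ∈ e, ∀ y ∈ e, x ∈ C → y ∈ C

theorem isKempeClosed_supp (F : Finset (Sym2 V)) (c : Sym2 V → ℕ) (a b : ℕ)
    (C : (bichromaticGraph F c a b).ConnectedComponent) : IsKempeClosed F c a b C.supp := by
  intro e he hc x hx y hy hxC
  by_cases hxy : x = y
  · exact hxy ▸ hxC
  have hexy : e = s(x, y) := (Sym2.mem_and_mem_iff hxy).1 ⟨hx, hy⟩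
  subst hexy
  have hadj : (bichromaticGraph F c a b).Adj x y := ⟨hxy, he, hc⟩
  exact (C.mem_supp_congr_adj hadj).1 hxC

section Kempe

variable {F : Finset (Sym2 V)} {P : Finset ℕ} {N : Finset V} {c : Sym2 V → ℕ}
  {A : V → Finset ℕ} {a b : ℕ} {C : Set V}

theorem kempeColoring_of_mem {e : Sym2 V} {v : V} (hve : v ∈ e) (hv : v ∈ C) :
    kempeColoring C a b c e = Equiv.swap a b (c e) :=
  if_pos ⟨v, hv, hve⟩

theorem IsKempeClosed.kempeColoring_of_notMem (hC : IsKempeClosed F c a b C) {e : Sym2 V}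
    (he : e ∈ F) {v : V} (hve : v ∈ e) (hv : v ∉ C) : kempeColoring C a b c e = c e := by
  unfold kempeColoring
  split_ifs with h
  · obtain ⟨x, hx, hxe⟩ := h
    by_cases hab : c e = a ∨ c e = b
    · exact absurd (hC e he hab x hxe v hve hx) hv
    · push Not at hab
      exact Equiv.swap_apply_of_ne_of_ne hab.1 hab.2
  · rfl

theorem swap_mem {i : ℕ} (ha : a ∈ P) (hb : b ∈ P) (hi : i ∈ P) : Equiv.swap a b i ∈ P := by
  rw [Equiv.swap_apply_def]
  split_ifs <;> assumption

theorem IsProperEdgeColoring.kempe (hc : IsProperEdgeColoring F P c) (ha : a ∈ P) (hb : b ∈ P)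
    (hC : IsKempeClosed F c a b C) : IsProperEdgeColoring F P (kempeColoring C a b c) := by
  constructor
  · intro e he
    unfold kempeColoring
    split_ifs
    · exact swap_mem ha hb (hc.1 e he)
    · exact hc.1 e he
  · intro e he f hf v hve hvf hef
    refine hc.2 e he f hf v hve hvf ?_
    by_cases hv : v ∈ C
    · rw [kempeColoring_of_mem hve hv, kempeColoring_of_mem hvf hv] at hef
      exact (Equiv.swap a b).injective hef
    · rwa [hC.kempeColoring_of_notMem he hve hv, hC.kempeColoring_of_notMem hf hvf hv] at hef

theorem IsFreeList.kempe (hA : IsFreeList F P N c A) (ha : a ∈ P) (hb : b ∈ P)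
    (hC : IsKempeClosed F c a b C) :
    IsFreeList F P N (kempeColoring C a b c) (kempeList C a b A) := by
  intro u hu
  by_cases huC : u ∈ C
  · refine ⟨fun i hi => ?_, fun e he hue => ?_⟩
    · rw [mem_kempeList_of_mem huC] at hi
      simpa using swap_mem ha hb ((hA u hu).1 hi)
    · rw [mem_kempeList_of_mem huC, kempeColoring_of_mem hue huC, Equiv.swap_apply_self]
      exact (hA u hu).2 e he hue
  · refine ⟨fun i hi => ?_, fun e he hue => ?_⟩
    · rw [mem_kempeList_of_notMem huC] at hi
      exact (hA u hu).1 hi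
    · rw [mem_kempeList_of_notMem huC, hC.kempeColoring_of_notMem he hue huC]
      exact (hA u hu).2 e he hue

open Classical in
/-- A Kempe chain contains at most two vertices at which a given one of its colours is free. -/
theorem IsProperEdgeColoring.card_component_le_two [Fintype V] (hc : IsProperEdgeColoring F P c)
    (K : (bichromaticGraph F c a b).ConnectedComponent) {X : Finset V}
    (hX : ∀ u ∈ X, ∀ e ∈ F, u ∈ e → c e ≠ a) : #{u ∈ X | u ∈ K.supp} ≤ 2 := by
  have hcard : #{u ∈ X | u ∈ K.supp} = #{u : K | (u : V) ∈ X} := by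
    symm
    refine card_bij (fun u _ => (u : V)) ?_ ?_ ?_
    · intro u hu
      exact mem_filter.2 ⟨(mem_filter.1 hu).2, u.2⟩
    · intro u _ v _ h
      exact Subtype.ext h
    · intro u hu
      obtain ⟨h₁, h₂⟩ := mem_filter.1 hu
      exact ⟨⟨u, h₂⟩, by simpa using h₁, rfl⟩
  have hinj (u : K) : Set.InjOn (fun w : K => c s((u : V), (w : V)))
      (K.toSimpleGraph.neighborFinset u) := by
    intro w hw z hz h
    simp only [SimpleGraph.coe_neighborFinset, SimpleGraph.mem_neighborSet] at hw hz
    exact Subtype.ext (Sym2.congr_right.1 (hc.2 _ hw.2.1 _ hz.2.1 u (by simp) (by simp) h))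
  rw [hcard]
  refine K.connected_toSimpleGraph.card_le_two_of_degree_le_one (fun u => ?_) fun u hu => ?_
  · rw [← SimpleGraph.card_neighborFinset_eq_degree]
    refine (card_le_card_of_injOn (t := {a, b}) _ (fun w hw => ?_) (hinj u)).trans card_le_two
    simp only [SimpleGraph.coe_neighborFinset, SimpleGraph.mem_neighborSet] at hw
    simpa using hw.2.2
  · rw [← SimpleGraph.card_neighborFinset_eq_degree, ← card_singleton b]
    refine card_le_card_of_injOn _ (fun w hw => ?_) (hinj u)
    simp only [SimpleGraph.coe_neighborFinset, SimpleGraph.mem_neighborSet] at hw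
    simpa using hw.2.2.resolve_left (hX u (by simpa using hu) _ hw.2.1 (by simp))

end Kempe
section Extension

variable [Fintype V]

/-- Kempe exchanges can make some colour free at exactly one vertex of `N`. -/
theorem exists_color_free_at_one_vertex {F : Finset (Sym2 V)} {P : Finset ℕ} {N : Finset V}
    {u₀ : V} (hu₀ : u₀ ∈ N) (hN : #N ≤ #P) {c : Sym2 V → ℕ} {A : V → Finset ℕ}
    (hc : IsProperEdgeColoring F P c) (hA : IsFreeList F P N c A) (h1 : #(A u₀) = 1)
    (h2 : ∀ u ∈ N, u ≠ u₀ → #(A u) = 2) :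
    ∃ c' A', IsProperEdgeColoring F P c' ∧ IsFreeList F P N c' A' ∧ (∀ u, #(A' u) = #(A u)) ∧
      ∃ i, ∃ u, {w ∈ N | i ∈ A' w} = {u} := by
  classical
  induction hΦ : ∑ i ∈ P, #{w ∈ N | i ∈ A w} ^ 2 using Nat.strong_induction_on
    generalizing c A with
  | _ Φ ih =>
  by_cases hex : ∃ i ∈ P, #{w ∈ N | i ∈ A w} = 1
  · obtain ⟨i, -, hi⟩ := hex
    exact ⟨c, A, hc, hA, fun _ => rfl, i, card_eq_one.1 hi⟩
  push Not at hex
  have hsum : ∑ i ∈ P, #{w ∈ N | i ∈ A w} + 1 = 2 * #N := by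
    have h := sum_card_bipartiteAbove_eq_sum_card_bipartiteBelow (s := P) (t := N)
      (fun i w => i ∈ A w)
    simp only [bipartiteAbove, bipartiteBelow] at h
    have h' : ∀ w ∈ N, #{i ∈ P | i ∈ A w} = #(A w) := fun w hw => by
      rw [filter_mem_eq_inter, inter_eq_right.2 (hA w hw).1]
    rw [h, sum_congr rfl h', ← add_sum_erase _ _ hu₀, h1,
      sum_congr rfl fun w hw => h2 w (mem_of_mem_erase hw) (ne_of_mem_erase hw)]
    have := card_erase_add_one hu₀
    simp only [sum_const, smul_eq_mul]
    omega
  obtain ⟨a, ha, b, hb, hab⟩ :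
      ∃ a ∈ P, ∃ b ∈ P, #{w ∈ N | b ∈ A w} + 2 < #{w ∈ N | a ∈ A w} := by
    by_contra! hle
    by_cases h0 : ∃ b ∈ P, #{w ∈ N | b ∈ A w} = 0
    · obtain ⟨b, hb, hb0⟩ := h0
      have : 2 ∣ ∑ i ∈ P, #{w ∈ N | i ∈ A w} := dvd_sum fun i hi => by
        have := hle i hi b hb
        have := hex i hi
        omega
      omega
    · push Not at h0
      have : ∑ _i ∈ P, 2 ≤ ∑ i ∈ P, #{w ∈ N | i ∈ A w} := sum_le_sum fun i hi => by
        have := h0 i hi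
        have := hex i hi
        omega
      simp only [sum_const, smul_eq_mul] at this
      omega
  have hne : a ≠ b := by
    rintro rfl
    omega
  obtain ⟨K, -, hK⟩ := exists_lt_of_sum_lt (s := univ)
    (f := fun K : (bichromaticGraph F c a b).ConnectedComponent => #{w ∈ N | b ∈ A w ∧ w ∈ K.supp})
    (g := fun K => #{w ∈ N | a ∈ A w ∧ w ∈ K.supp}) (by
      have hfib (i : ℕ) : ∑ K : (bichromaticGraph F c a b).ConnectedComponent,
          #{w ∈ N | i ∈ A w ∧ w ∈ K.supp} = #{w ∈ N | i ∈ A w} := by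
        rw [card_eq_sum_card_fiberwise (f := (bichromaticGraph F c a b).connectedComponentMk)
          (t := univ) (fun _ _ => mem_coe.2 (mem_univ _))]
        simp only [filter_filter, SimpleGraph.ConnectedComponent.mem_supp_iff]
      rw [hfib, hfib]
      omega)
  have htwo : #{w ∈ N | a ∈ A w ∧ w ∈ K.supp} ≤ 2 := by
    rw [← filter_filter]
    refine hc.card_component_le_two K fun u hu e he hue h => ?_
    obtain ⟨hu, hau⟩ := mem_filter.1 hu
    exact (hA u hu).2 e he hue (h ▸ hau)
  have hcl := isKempeClosed_supp F c a b K
  have hsplit (i : ℕ) : #{w ∈ N | i ∈ A w} =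
      #{w ∈ N | i ∈ A w ∧ w ∈ K.supp} + #{w ∈ N | i ∈ A w ∧ w ∉ K.supp} := by
    rw [← card_filter_add_card_filter_not (s := {w ∈ N | i ∈ A w}) (· ∈ K.supp), filter_filter,
      filter_filter]
  have hsplit' (i : ℕ) : #{w ∈ N | i ∈ kempeList K.supp a b A w} =
      #{w ∈ N | Equiv.swap a b i ∈ A w ∧ w ∈ K.supp} + #{w ∈ N | i ∈ A w ∧ w ∉ K.supp} := by
    rw [← card_filter_add_card_filter_not (s := {w ∈ N | i ∈ kempeList K.supp a b A w}) (· ∈ K.supp),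
      filter_filter, filter_filter]
    congr 2 <;> refine filter_congr fun w _ => ?_
    · exact and_congr_left fun hw => mem_kempeList_of_mem hw i
    · exact and_congr_left fun hw => mem_kempeList_of_notMem hw i
  have hlt : ∑ i ∈ P, #{w ∈ N | i ∈ kempeList K.supp a b A w} ^ 2 < Φ := by
    have hb' : b ∈ P.erase a := mem_erase.2 ⟨hne.symm, hb⟩
    rw [← hΦ, ← add_sum_erase P _ ha, ← add_sum_erase P _ ha, ← add_sum_erase _ _ hb',
      ← add_sum_erase _ _ hb', ← add_assoc, ← add_assoc]
    refine add_lt_add_of_lt_of_le ?_ (le_of_eq (sum_congr rfl fun i hi => ?_))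
    · have ha₁ := hsplit a
      have hb₁ := hsplit b
      have ha₂ := hsplit' a
      have hb₂ := hsplit' b
      rw [Equiv.swap_apply_left] at ha₂
      rw [Equiv.swap_apply_right] at hb₂
      generalize #{w ∈ N | a ∈ A w} = x at *
      generalize #{w ∈ N | b ∈ A w} = y at *
      generalize #{w ∈ N | a ∈ kempeList K.supp a b A w} = x' at *
      generalize #{w ∈ N | b ∈ kempeList K.supp a b A w} = y' at *
      have : (x' + 1 = x ∧ y' = y + 1) ∨ (x' + 2 = x ∧ y' = y + 2) := by omega
      rcases this with ⟨rfl, rfl⟩ | ⟨rfl, rfl⟩ <;> nlinarith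
    · simp only [mem_erase] at hi
      rw [hsplit', hsplit, Equiv.swap_apply_of_ne_of_ne hi.2.1 hi.1]
  have hcard := card_kempeList K.supp a b A
  obtain ⟨c', A', h⟩ := ih _ hlt (hc.kempe ha hb hcl) (hA.kempe ha hb hcl)
    (by rw [hcard, h1]) (fun u hu hne => by rw [hcard, h2 u hu hne]) rfl
  exact ⟨c', A', h.1, h.2.1, fun u => by rw [h.2.2.1, hcard], h.2.2.2⟩

variable [DecidableEq V]

/-- A proper edge colouring extends to a new vertex `v` with neighbourhood `N`, provided there are
at least `#N` colours and two colours are free at each vertex of `N`, with at most one exception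
at which one colour is free. -/
theorem IsProperEdgeColoring.exists_extension {F : Finset (Sym2 V)} {P : Finset ℕ}
    {N : Finset V} {c : Sym2 V → ℕ} {A : V → Finset ℕ} {v u₀ : V} (hv : ∀ e ∈ F, v ∉ e)
    (hvN : v ∉ N) (hc : IsProperEdgeColoring F P c) (hA : IsFreeList F P N c A)
    (hN : #N ≤ #P) (h1 : ∀ u ∈ N, 1 ≤ #(A u)) (h2 : ∀ u ∈ N, u ≠ u₀ → 2 ≤ #(A u)) :
    ∃ c', IsProperEdgeColoring (F ∪ N.image fun u => s(v, u)) P c' := by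
  induction hn : #N generalizing F P N c A u₀ with
  | zero =>
    obtain rfl := card_eq_zero.1 hn
    exact ⟨c, by simpa using hc⟩
  | succ n ih =>
  obtain ⟨u₁, hu₁, h2⟩ : ∃ u₁ ∈ N, ∀ u ∈ N, u ≠ u₁ → 2 ≤ #(A u) := by
    by_cases h : u₀ ∈ N
    · exact ⟨u₀, h, h2⟩
    · obtain ⟨u₁, hu₁⟩ := card_pos.1 (by omega : 0 < #N)
      exact ⟨u₁, hu₁, fun u hu _ => h2 u hu fun h' => h (h' ▸ hu)⟩
  have hB (u) : ∃ B, u ∈ N → B ⊆ A u ∧ #B = if u = u₁ then 1 else 2 := by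
    by_cases hu : u ∈ N
    · obtain ⟨B, hB⟩ := exists_subset_card_eq (s := A u) (n := if u = u₁ then 1 else 2) (by
        split_ifs with h
        exacts [h1 u hu, h2 u hu h])
      exact ⟨B, fun _ => hB⟩
    · exact ⟨∅, fun h => absurd h hu⟩
  choose B hB using hB
  have hBfree : IsFreeList F P N c B := fun u hu =>
    ⟨(hB u hu).1.trans (hA u hu).1, fun e he hue h => (hA u hu).2 e he hue ((hB u hu).1 h)⟩
  obtain ⟨c', A', hc', hA', hcard, i, u, hiu⟩ := exists_color_free_at_one_vertex hu₁ hN hc hBfree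
    (by simpa using (hB u₁ hu₁).2) (fun u hu hne => by simpa [hne] using (hB u hu).2)
  obtain ⟨huN, hiA⟩ : u ∈ N ∧ i ∈ A' u := by
    simpa using (Finset.ext_iff.1 hiu u).2 (mem_singleton_self u)
  have hiw (w) (hw : w ∈ N) (hwu : w ≠ u) : i ∉ A' w := fun h =>
    hwu (mem_singleton.1 (hiu ▸ mem_filter.2 ⟨hw, h⟩))
  have hiP : i ∈ P := (hA' u huN).1 hiA
  have hcardN := card_erase_add_one huN
  have hcardP := card_erase_add_one hiP
  obtain ⟨d, hd⟩ := ih (F := {e ∈ F | c' e ≠ i}) (P := P.erase i) (N := N.erase u) (c := c')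
    (A := A') (u₀ := u₁) (fun e he => hv e (mem_filter.1 he).1)
    (fun h => hvN (mem_of_mem_erase h))
    ⟨fun e he => mem_erase.2 ⟨(mem_filter.1 he).2, hc'.1 e (mem_filter.1 he).1⟩,
      fun e he f hf => hc'.2 e (mem_filter.1 he).1 f (mem_filter.1 hf).1⟩
    (fun w hw => ⟨fun j hj => mem_erase.2
        ⟨fun h => hiw w (mem_of_mem_erase hw) (ne_of_mem_erase hw) (h ▸ hj),
          (hA' w (mem_of_mem_erase hw)).1 hj⟩,
      fun e he => (hA' w (mem_of_mem_erase hw)).2 e (mem_filter.1 he).1⟩)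
    (by omega)
    (fun w hw => by
      rw [hcard, (hB w (mem_of_mem_erase hw)).2]
      split_ifs <;> omega)
    (fun w hw hne => by rw [hcard, (hB w (mem_of_mem_erase hw)).2, if_neg hne])
    (by omega)
  let T (e : Sym2 V) : Prop := (e ∈ F ∧ c' e = i) ∨ e = s(v, u)
  have hT (e) (he : e ∈ F ∪ N.image fun u => s(v, u)) (hTe : ¬ T e) :
      e ∈ ({e ∈ F | c' e ≠ i} ∪ (N.erase u).image fun u => s(v, u)) := by
    simp only [T, not_or, not_and] at hTe
    simp only [mem_union, mem_image, mem_filter, mem_erase] at he ⊢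
    rcases he with he | ⟨w, hw, rfl⟩
    · exact .inl ⟨he, hTe.1 he⟩
    · exact .inr ⟨w, ⟨fun h => hTe.2 (h ▸ rfl), hw⟩, rfl⟩
  have hTdisj (e w) (he : e ∈ F ∧ c' e = i) (hwe : w ∈ e) : w ∉ s(v, u) := by
    intro hw
    rcases Sym2.mem_iff.1 hw with rfl | rfl
    · exact hv e he.1 hwe
    · exact (hA' w huN).2 e he.1 hwe (he.2 ▸ hiA)
  classical
  refine ⟨fun e => if T e then i else d e, fun e he => ?_, fun e he f hf w hwe hwf hef => ?_⟩
  · by_cases hTe : T e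
    · simpa only [hTe, if_true] using hiP
    · simpa only [hTe, if_false] using mem_of_mem_erase (hd.1 e (hT e he hTe))
  · by_cases hTe : T e <;> by_cases hTf : T f <;>
      simp only [hTe, hTf, if_true, if_false] at hef
    · rcases hTe with hTe | rfl <;> rcases hTf with hTf | rfl
      · exact hc'.2 e hTe.1 f hTf.1 w hwe hwf (hTe.2.trans hTf.2.symm)
      · exact absurd hwf (hTdisj e w hTe hwe)
      · exact absurd hwe (hTdisj f w hTf hwf)
      · rfl
    · exact absurd hef.symm (ne_of_mem_erase (hd.1 f (hT f hf hTf)))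
    · exact absurd hef (ne_of_mem_erase (hd.1 e (hT e he hTe)))
    · exact hd.2 e (hT e he hTe) f (hT f hf hTf) w hwe hwf hef

/-- Vizing's theorem in a strengthened form: `k` colours suffice if all degrees are at most `k`
and no two vertices of degree `k` are adjacent. -/
theorem exists_isProperEdgeColoring {k : ℕ} {F : Finset (Sym2 V)}
    (hdiag : ∀ e ∈ F, ¬ e.IsDiag) (hk : ∀ v, degF F v ≤ k)
    (hadj : ∀ u v, s(u, v) ∈ F → degF F u < k ∨ degF F v < k) :
    ∃ c, IsProperEdgeColoring F (range k) c := by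
  induction hn : #F using Nat.strong_induction_on generalizing F with
  | _ n ih =>
  obtain rfl | hne := F.eq_empty_or_nonempty
  · exact ⟨fun _ => 0, by simp [IsProperEdgeColoring]⟩
  obtain ⟨v, w, hvw, hnbr⟩ :
      ∃ v w, s(v, w) ∈ F ∧ ∀ u, s(v, u) ∈ F → degF F u < k := by
    by_cases h : ∃ v w, s(v, w) ∈ F ∧ degF F v = k
    · obtain ⟨v, w, hvw, hv⟩ := h
      exact ⟨v, w, hvw, fun u hu => (hadj v u hu).resolve_left (by omega)⟩
    · push Not at h
      obtain ⟨⟨v, w⟩, he⟩ := hne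
      exact ⟨v, w, he, fun u hu => lt_of_le_of_ne (hk u) (h u v (Sym2.eq_swap ▸ hu))⟩
  have hsub : {e ∈ F | v ∉ e} ⊆ F := filter_subset _ _
  have hmono (u) : degF {e ∈ F | v ∉ e} u ≤ degF F u :=
    card_le_card (filter_subset_filter _ hsub)
  obtain ⟨c, hc⟩ := ih #{e ∈ F | v ∉ e}
    (hn ▸ card_lt_card (filter_ssubset.2 ⟨_, hvw, by simp⟩))
    (fun e he => hdiag e (hsub he)) (fun u => (hmono u).trans (hk u))
    (fun x y hxy => (hadj x y (hsub hxy)).imp (hmono x).trans_lt (hmono y).trans_lt) rfl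
  have hfree : IsFreeList {e ∈ F | v ∉ e} (range k) {u | s(v, u) ∈ F} c
      fun u => range k \ ({e ∈ {e ∈ F | v ∉ e} | u ∈ e}.image c) := fun u _ =>
    ⟨sdiff_subset, fun e he hue h =>
      (mem_sdiff.1 h).2 (mem_image_of_mem c (mem_filter.2 ⟨he, hue⟩))⟩
  have htwo (u) (hu : u ∈ ({u | s(v, u) ∈ F} : Finset V)) :
      2 ≤ #(range k \ ({e ∈ {e ∈ F | v ∉ e} | u ∈ e}.image c)) := by
    have hu : s(v, u) ∈ F := (mem_filter.1 hu).2
    have h₁ := le_card_sdiff ({e ∈ {e ∈ F | v ∉ e} | u ∈ e}.image c) (range k)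
    have h₂ : #({e ∈ {e ∈ F | v ∉ e} | u ∈ e}.image c) ≤ degF {e ∈ F | v ∉ e} u := card_image_le
    have h₃ : degF {e ∈ F | v ∉ e} u < degF F u :=
      card_lt_card ⟨filter_subset_filter _ hsub, fun h => by
        have := h (mem_filter.2 ⟨hu, Sym2.mem_mk_right v u⟩)
        simp at this⟩
    have := hnbr u hu
    rw [card_range] at h₁
    omega
  have hN : #{u | s(v, u) ∈ F} ≤ #(range k) := by
    rw [← degF_eq_card_neighbors, card_range]
    exact hk v
  obtain ⟨d, hd⟩ := hc.exists_extension (v := v) (u₀ := v) (fun e he => (mem_filter.1 he).2)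
    (fun h => hdiag _ (mem_filter.1 h).2 (Sym2.mk_isDiag_iff.2 rfl)) hfree hN
    (fun u hu => one_le_two.trans (htwo u hu)) (fun u hu _ => htwo u hu)
  refine ⟨d, ?_⟩
  convert hd using 1
  ext e
  simp only [mem_union, mem_filter, mem_image, mem_univ, true_and]
  constructor
  · intro he
    by_cases hve : v ∈ e
    · obtain ⟨u, rfl⟩ := hve
      exact .inr ⟨u, he, rfl⟩
    · exact .inl ⟨he, hve⟩
  · rintro (h | ⟨u, hu, rfl⟩)
    exacts [h.1, hu]

end Extension

end EdgeColoring

section MatchingCover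

variable {V : Type*} [DecidableEq V]

theorem IsMatching.degF_le_one {G : SimpleGraph V} {M : Finset (Sym2 V)} (hM : IsMatching G M)
    (v : V) : degF M v ≤ 1 :=
  card_le_one.2 fun e he f hf => by
    obtain ⟨he, hve⟩ := mem_filter.1 he
    obtain ⟨hf, hvf⟩ := mem_filter.1 hf
    by_contra hef
    exact hM.2 he hf hef v ⟨hve, hvf⟩

theorem degF_sup_le {G : SimpleGraph V} {k : ℕ} {M : Fin k → Finset (Sym2 V)}
    (hM : ∀ i, IsMatching G (M i)) (v : V) : degF (univ.sup M) v ≤ k := by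
  rw [sup_eq_biUnion]
  unfold degF
  rw [filter_biUnion]
  refine card_biUnion_le.trans ((sum_le_sum fun i _ => (hM i).degF_le_one v).trans ?_)
  simp

theorem IsProperEdgeColoring.exists_matchings {G : SimpleGraph V} {k : ℕ} {F : Finset (Sym2 V)}
    {c : Sym2 V → ℕ} (hF : ↑F ⊆ G.edgeSet) (hc : IsProperEdgeColoring F (range k) c) :
    ∃ M : Fin k → Finset (Sym2 V), (∀ i, IsMatching G (M i)) ∧
      (∀ i j, i ≠ j → Disjoint (M i) (M j)) ∧ univ.sup M = F := by
  refine ⟨fun i => {e ∈ F | c e = i}, fun i => ⟨fun e he => hF (mem_filter.1 he).1, ?_⟩, ?_, ?_⟩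
  · rintro e he f hf hef v ⟨hve, hvf⟩
    obtain ⟨he, hce⟩ := mem_filter.1 he
    obtain ⟨hf, hcf⟩ := mem_filter.1 hf
    exact hef (hc.2 e he f hf v hve hvf (hce.trans hcf.symm))
  · intro i j hij
    refine disjoint_filter.2 fun e _ hi hj => hij (Fin.ext (hi.symm.trans hj))
  · ext e
    simp only [mem_sup, mem_univ, true_and, mem_filter]
    exact ⟨fun ⟨_, he, _⟩ => he, fun he => ⟨⟨c e, mem_range.1 (hc.1 e he)⟩, he, rfl⟩⟩

variable [Fintype V]

theorem IsFeasible.sum_le {G : SimpleGraph V} [DecidableRel G.Adj] {k : ℕ} {ℓ : V → ℕ}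
    {F : Finset (Sym2 V)} (hF : IsFeasible G k F) (hℓ : ∀ v, ℓ v ≤ degF F v) (X : Finset V) :
    ∑ x ∈ Xᶜ, (ℓ x - #{y ∈ G.neighborFinset x | y ∉ X}) ≤ k * #X := calc
  _ ≤ ∑ x ∈ Xᶜ, #{y ∈ X | s(x, y) ∈ F} := sum_le_sum fun x _ => by
      have h₁ : #{y | s(x, y) ∈ F ∧ y ∉ X} ≤ #{y ∈ G.neighborFinset x | y ∉ X} :=
        card_le_card fun y hy => by
          simp only [mem_filter, SimpleGraph.mem_neighborFinset, mem_univ, true_and] at hy ⊢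
          exact ⟨hF.1 hy.1, hy.2⟩
      have h₂ : #{y ∈ X | s(x, y) ∈ F} + #{y | s(x, y) ∈ F ∧ y ∉ X} = degF F x := by
        rw [degF_eq_card_neighbors,
          ← card_filter_add_card_filter_not (s := {w | s(x, w) ∈ F}) (· ∈ X)]
        congr 2 <;> ext y <;> simp [and_comm]
      have := hℓ x
      omega
  _ = ∑ y ∈ X, #{x ∈ Xᶜ | s(y, x) ∈ F} := sum_card_edges_comm F _ _
  _ ≤ ∑ y ∈ X, k := sum_le_sum fun y _ => by
      refine le_trans ?_ (hF.2 y)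
      rw [degF_eq_card_neighbors]
      exact card_le_card (filter_subset_filter _ (subset_univ _))
  _ = k * #X := by simp [mul_comm]

/-- An edge-minimal edge set with degrees between `ℓ` and `k` has no edge joining two vertices of
degree `k`. -/
theorem exists_degree_between_of_stable {G : SimpleGraph V} {k : ℕ} {ℓ : V → ℕ}
    (hℓ : ∀ v, ℓ v < k) (h : ∃ F, IsFeasible G k F ∧ ∀ v, ℓ v ≤ degF F v) :
    ∃ F, IsFeasible G k F ∧ (∀ v, ℓ v ≤ degF F v) ∧
      ∀ u v, s(u, v) ∈ F → degF F u < k ∨ degF F v < k := by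
  classical
  obtain ⟨F₀, hF₀⟩ := h
  obtain ⟨F, hF, hmin⟩ := exists_min_image
    {F : Finset (Sym2 V) | IsFeasible G k F ∧ ∀ v, ℓ v ≤ degF F v} card ⟨F₀, by simpa using hF₀⟩
  simp only [mem_filter, mem_univ, true_and] at hF hmin
  refine ⟨F, hF.1, hF.2, fun u v huv => ?_⟩
  by_contra! hk
  have hdeg := degF_erase huv
  refine absurd (hmin (F.erase s(u, v)) ⟨⟨fun e he => hF.1.1 (mem_of_mem_erase he), fun x => ?_⟩,
    fun x => ?_⟩) (not_le.2 (card_erase_lt_of_mem huv))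
  · have := hdeg x
    have := hF.1.2 x
    omega
  · have := hdeg x
    have := hF.2 x
    have := hℓ x
    simp only [Sym2.mem_iff] at *
    grind

end MatchingCover

theorem stmt_11 {V : Type*} [Fintype V] [DecidableEq V] (G : SimpleGraph V) [DecidableRel G.Adj]
    (k : ℕ) (hk : 2 ≤ k) (ℓ : V → ℕ) (hℓ : ∀ v, ℓ v < k) :
    (∃ M : Fin k → Finset (Sym2 V),
        (∀ i, IsMatching G (M i)) ∧
        (∀ i j, i ≠ j → Disjoint (M i) (M j)) ∧
        ∀ v : V, ℓ v ≤ degF (Finset.univ.sup M) v) ↔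
      ∀ X : Finset V,
        ∑ x ∈ Xᶜ, (ℓ x - ((G.neighborFinset x).filter fun y => y ∉ X).card) ≤ k * X.card := by
  constructor
  · rintro ⟨M, hM, -, hdeg⟩ X
    refine IsFeasible.sum_le (F := univ.sup M) ⟨fun e he => ?_, degF_sup_le hM⟩ hdeg X
    obtain ⟨i, -, hi⟩ := mem_sup.1 (mem_coe.1 he)
    exact (hM i).1 hi
  · intro h
    obtain ⟨F, hF, hdeg, hstable⟩ :=
      exists_degree_between_of_stable hℓ (exists_degree_between G k ℓ hℓ h)
    obtain ⟨c, hc⟩ := exists_isProperEdgeColoring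
      (fun e he => G.not_isDiag_of_mem_edgeSet (hF.1 he)) hF.2 hstable
    obtain ⟨M, hM, hdisj, hsup⟩ := hc.exists_matchings hF.1
    exact ⟨M, hM, hdisj, hsup ▸ hdeg⟩
end

section
/- Let G be a connected graph with at least 2 vertices. The minimum number k of matchings whose union covers all vertices of G equals max over nonempty stable sets S of ⌈|S|/|N(S)|⌉, unless this maximum equals 1, in which case the minimum is 1 if G has a perfect matching and 2 otherwise. -/
/-- If every stable set satisfies `|S| ≤ k |N(S)|`, then every vertex can choose a neighbor so that
each vertex is chosen at most `k` times. -/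
theorem exists_adj_choice {V : Type*} [Fintype V] [DecidableEq V] (G : SimpleGraph V)
    [DecidableRel G.Adj] (k : ℕ) (hk : 1 ≤ k)
    (h : ∀ S : Finset V, IsStable G S → S.card ≤ k * (nbr G S).card) :
    ∃ f : V → V, (∀ v, G.Adj v (f v)) ∧
      ∀ x, (Finset.univ.filter fun v => f v = x).card ≤ k := by
  have hall : ∀ S : Finset V, S.card ≤
      (S.biUnion fun v => G.neighborFinset v ×ˢ (Finset.univ : Finset (Fin k))).card := by
    intro S
    set I := S.filter fun v => ∀ u ∈ S, ¬ G.Adj v u with hI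
    have hstable : IsStable G I := by
      intro u hu v hv
      simp only [hI, Finset.mem_filter] at hu hv
      exact hu.2 v hv.1
    have hdisj : Disjoint (S \ I) (nbr G I) := by
      rw [Finset.disjoint_left]
      intro w hw hw'
      simp only [nbr, Finset.mem_filter, Finset.mem_univ, true_and] at hw'
      obtain ⟨-, u, hu, huw⟩ := hw'
      exact (Finset.mem_filter.1 hu).2 w (Finset.mem_sdiff.1 hw).1 huw
    have hsub : ((S \ I) ∪ nbr G I) ×ˢ (Finset.univ : Finset (Fin k)) ⊆
        S.biUnion fun v => G.neighborFinset v ×ˢ (Finset.univ : Finset (Fin k)) := by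
      rintro ⟨w, i⟩ hw
      simp only [Finset.mem_product, Finset.mem_union, Finset.mem_univ, and_true,
        Finset.mem_biUnion, SimpleGraph.mem_neighborFinset] at hw ⊢
      rcases hw with hw | hw
      · obtain ⟨hwS, hwI⟩ := Finset.mem_sdiff.1 hw
        simp only [hI, Finset.mem_filter, hwS, true_and] at hwI
        push Not at hwI
        obtain ⟨u, hu, hwu⟩ := hwI
        exact ⟨u, hu, hwu.symm⟩
      · simp only [nbr, Finset.mem_filter, Finset.mem_univ, true_and] at hw
        obtain ⟨-, u, hu, huw⟩ := hw
        exact ⟨u, (Finset.mem_filter.1 hu).1, huw⟩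
    refine le_trans ?_ (Finset.card_le_card hsub)
    rw [Finset.card_product, Finset.card_union_of_disjoint hdisj, Finset.card_univ,
      Fintype.card_fin]
    have h₁ := h I hstable
    have h₂ := Finset.card_sdiff_add_card_eq_card (Finset.filter_subset _ S : I ⊆ S)
    nlinarith [Nat.le_mul_of_pos_right (S \ I).card hk]
  obtain ⟨g, hg, hmem⟩ := (Finset.all_card_le_biUnion_card_iff_exists_injective _).1 hall
  refine ⟨fun v => (g v).1, fun v => ?_, fun x => ?_⟩
  · exact (G.mem_neighborFinset _ _).1 (Finset.mem_product.1 (hmem v)).1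
  · have := Finset.card_le_card_of_injOn (s := Finset.univ.filter fun v => (g v).1 = x)
      (t := (Finset.univ : Finset (Fin k))) (fun v => (g v).2)
      (fun _ _ => Finset.mem_coe.2 (Finset.mem_univ _))
      (by
        intro u hu v hv huv
        simp only [Finset.coe_filter, Finset.mem_univ, true_and, Set.mem_ofPred_eq] at hu hv
        exact hg (Prod.ext (hu.trans hv.symm) huv))
    simpa using this

/-- For a self-map `f` of a finite type there are sets `L ⊆ T` such that `f '' L` is the complement
of `T`, `f '' T` is the complement of `L`, and `f` is injective on `T \ L`. -/
theorem exists_kernel_pair {V : Type*} [Fintype V] (f : V → V) :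
    ∃ L T : Set V, L ⊆ T ∧ L = (f '' T)ᶜ ∧ T = (f '' L)ᶜ ∧ Set.InjOn f (T \ L) := by
  let Φ : Set V →o Set V :=
    ⟨fun L => (f '' (f '' L)ᶜ)ᶜ, fun A B hAB => Set.compl_subset_compl.2
      (Set.image_mono (Set.compl_subset_compl.2 (Set.image_mono hAB)))⟩
  set L := OrderHom.lfp Φ
  have hL : (f '' (f '' L)ᶜ)ᶜ = L := Φ.map_lfp
  have hLT : L ⊆ (f '' L)ᶜ := Φ.lfp_le_fixed (congrArg (fun A => (f '' A)ᶜ) hL)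
  refine ⟨L, (f '' L)ᶜ, hLT, hL.symm, rfl, ?_⟩
  have hsub : (f '' L)ᶜ \ L ⊆ f '' ((f '' L)ᶜ \ L) := by
    rintro x ⟨hxT, hxL⟩
    rw [← hL, Set.notMem_compl_iff] at hxL
    obtain ⟨y, hyT, rfl⟩ := hxL
    exact ⟨y, ⟨hyT, fun hyL => hxT ⟨y, hyL, rfl⟩⟩, rfl⟩
  have hfin := Set.toFinite ((f '' L)ᶜ \ L)
  exact Set.injOn_of_ncard_image_eq
    (le_antisymm (Set.ncard_image_le hfin) (Set.ncard_le_ncard hsub (hfin.image f))) hfin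

/-- If every stable set satisfies `|S| ≤ k |N(S)|` with `k ≥ 2`, there is an edge cover in which all
degrees are at most `k`. -/
theorem exists_edge_cover_degF_le {V : Type*} [Fintype V] [DecidableEq V] (G : SimpleGraph V)
    [DecidableRel G.Adj] (k : ℕ) (hk : 2 ≤ k)
    (h : ∀ S : Finset V, IsStable G S → S.card ≤ k * (nbr G S).card) :
    ∃ F : Finset (Sym2 V), (F : Set (Sym2 V)) ⊆ G.edgeSet ∧ (∀ v, Covers F v) ∧
      ∀ v, degF F v ≤ k := by
  classical
  obtain ⟨f, hadj, hfib⟩ := exists_adj_choice G k (by omega) h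
  obtain ⟨L, T, hLT, hL, hT, hinj⟩ := exists_kernel_pair f
  have mem_T : ∀ x, x ∈ T ↔ ∀ u ∈ L, f u ≠ x := fun x => by
    conv_lhs => rw [hT]
    simp
  have mem_L : ∀ x, x ∈ L ↔ ∀ u ∈ T, f u ≠ x := fun x => by
    conv_lhs => rw [hL]
    simp
  refine ⟨(Finset.univ.filter (· ∈ T)).image fun v => s(v, f v), ?_, fun x => ?_, fun x => ?_⟩
  · intro e he
    simp only [Finset.coe_image, Set.mem_image] at he
    obtain ⟨v, -, rfl⟩ := he
    exact hadj v
  · by_cases hx : x ∈ T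
    · exact ⟨s(x, f x), Finset.mem_image_of_mem _ (by simpa using hx), by simp⟩
    · have hxL : x ∉ L := fun hxL => hx (hLT hxL)
      rw [mem_L] at hxL
      push Not at hxL
      obtain ⟨u, hu, rfl⟩ := hxL
      exact ⟨s(u, f u), Finset.mem_image_of_mem _ (by simpa using hu), by simp⟩
  · have hsub : ((Finset.univ.filter (· ∈ T)).image fun v => s(v, f v)).filter (x ∈ ·) ⊆
        (Finset.univ.filter fun v => v ∈ T ∧ (x = v ∨ x = f v)).image fun v => s(v, f v) := by
      intro e he
      simp only [Finset.mem_filter, Finset.mem_image, Finset.mem_univ, true_and] at he ⊢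
      obtain ⟨⟨v, hv, rfl⟩, hx⟩ := he
      exact ⟨v, ⟨hv, Sym2.mem_iff.1 hx⟩, rfl⟩
    refine (Finset.card_le_card hsub).trans (Finset.card_image_le.trans ?_)
    by_cases hx : x ∈ T
    · refine le_trans ?_ hk
      by_cases hxT : ∃ u ∈ T, f u = x
      · obtain ⟨u, hu, hux⟩ := hxT
        have aux : ∀ v, v ∈ T → f v = x → v ∈ T \ L := fun v hv hvx =>
          ⟨hv, fun hvL => (mem_T x).1 hx v hvL hvx⟩
        refine (Finset.card_le_card (t := {x, u}) ?_).trans Finset.card_le_two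
        intro v hv
        simp only [Finset.mem_filter, Finset.mem_univ, true_and] at hv
        rcases hv with ⟨hvT, rfl | hvx⟩
        · simp
        · simp [hinj (aux v hvT hvx.symm) (aux u hu hux) (hvx.symm.trans hux.symm)]
      · refine (Finset.card_le_card (t := {x}) ?_).trans (by simp)
        intro v hv
        simp only [Finset.mem_filter, Finset.mem_univ, true_and] at hv
        rcases hv with ⟨hvT, rfl | hvx⟩
        · simp
        · exact absurd ⟨v, hvT, hvx.symm⟩ hxT
    · refine (Finset.card_le_card ?_).trans (hfib x)
      intro v hv
      simp only [Finset.mem_filter, Finset.mem_univ, true_and] at hv ⊢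
      rcases hv with ⟨hvT, rfl | hvx⟩
      · exact absurd hvT hx
      · exact hvx.symm

/-- An edge cover contains an edge cover whose components are stars. -/
theorem exists_star_cover {V : Type*} [DecidableEq V] (F₀ : Finset (Sym2 V))
    (hF₀ : ∀ v, Covers F₀ v) :
    ∃ F ⊆ F₀, (∀ v, Covers F v) ∧
      ∀ e ∈ F, ∃ c, ∀ x ∈ e, x ≠ c → ∀ g ∈ F, x ∈ g → g = e := by
  obtain ⟨F, hsub, hmin⟩ := exists_minimal_le_of_wellFoundedLT
    (fun F : Finset (Sym2 V) => ∀ v, Covers F v) F₀ hF₀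
  refine ⟨F, hsub, hmin.prop, fun e he => ?_⟩
  have hnot := hmin.not_prop_of_lt (Finset.erase_ssubset he)
  push Not at hnot
  obtain ⟨v, hv⟩ := hnot
  have hunique : ∀ g ∈ F, v ∈ g → g = e := fun g hg hvg => by
    by_contra hne
    exact hv ⟨g, Finset.mem_erase.2 ⟨hne, hg⟩, hvg⟩
  obtain ⟨g, hg, hvg⟩ := hmin.prop v
  obtain rfl := hunique g hg hvg
  obtain ⟨w, rfl⟩ := Sym2.mem_iff_exists.1 hvg
  refine ⟨w, fun x hx hxw => ?_⟩
  obtain rfl : x = v := (Sym2.mem_iff.1 hx).resolve_right hxw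
  exact hunique

/-- An edge cover with all degrees at most `k` yields `k` matchings covering all vertices. -/
theorem exists_matchings_of_edge_cover {V : Type*} [DecidableEq V]
    (G : SimpleGraph V) (k : ℕ) (hk : 1 ≤ k) (F₀ : Finset (Sym2 V))
    (hG : (F₀ : Set (Sym2 V)) ⊆ G.edgeSet) (hF₀ : ∀ v, Covers F₀ v) (hdeg : ∀ v, degF F₀ v ≤ k) :
    ∃ M : Fin k → Finset (Sym2 V), (∀ i, IsMatching G (M i)) ∧ ∀ v : V, ∃ i, Covers (M i) v := by
  rcases isEmpty_or_nonempty V with hV | hV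
  · exact ⟨fun _ => ∅, fun _ => by simp [IsMatching], isEmptyElim⟩
  obtain ⟨F, hsub, hcov, hstar⟩ := exists_star_cover F₀ hF₀
  have hcol : ∀ v, ∃ c : Sym2 V → Fin k, Set.InjOn c (F.filter fun e => v ∈ e) := fun v => by
    have hle : (F.filter fun e => v ∈ e).card ≤ (Finset.univ : Finset (Fin k)).card := by
      rw [Finset.card_univ, Fintype.card_fin]
      exact (Finset.card_le_card (Finset.filter_subset_filter _ hsub)).trans (hdeg v)
    have : Nonempty (Fin k) := ⟨⟨0, hk⟩⟩
    obtain ⟨c, -, hc⟩ := (F.filter fun e => v ∈ e).finite_toSet.exists_injOn_of_encard_le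
      (t := ((Finset.univ : Finset (Fin k)) : Set (Fin k)))
      (by simpa only [Set.encard_coe_eq_coe_finsetCard, Nat.cast_le] using hle)
    exact ⟨c, hc⟩
  choose c hc using hcol
  choose! center hcenter using hstar
  refine ⟨fun i => F.filter fun e => c (center e) e = i, fun i => ⟨fun e he => ?_, ?_⟩,
    fun v => ?_⟩
  · exact hG (hsub (Finset.mem_filter.1 he).1)
  · intro e he g hg hne v ⟨hve, hvg⟩
    obtain ⟨heF, hei⟩ := Finset.mem_filter.1 he
    obtain ⟨hgF, hgi⟩ := Finset.mem_filter.1 hg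
    have h₁ : v = center e := by
      by_contra hv
      exact hne (hcenter e heF v hve hv g hgF hvg).symm
    have h₂ : v = center g := by
      by_contra hv
      exact hne (hcenter g hgF v hvg hv e heF hve)
    rw [← h₁] at hei
    rw [← h₂] at hgi
    exact hne (hc v (by simp [heF, hve]) (by simp [hgF, hvg]) (hei.trans hgi.symm))
  · obtain ⟨e, he, hve⟩ := hcov v
    exact ⟨c (center e) e, e, by simp [he], hve⟩

/-- If `k` matchings cover all vertices, every stable set satisfies `|S| ≤ k |N(S)|`. -/
theorem card_le_of_matchings {V : Type*} [Fintype V] [DecidableEq V] (G : SimpleGraph V)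
    [DecidableRel G.Adj] (k : ℕ) (M : Fin k → Finset (Sym2 V)) (hM : ∀ i, IsMatching G (M i))
    (hcov : ∀ v : V, ∃ i, Covers (M i) v) (S : Finset V) (hS : IsStable G S) :
    S.card ≤ k * (nbr G S).card := by
  have hpartner : ∀ v, ∃ p : V × Fin k, s(v, p.1) ∈ M p.2 := fun v => by
    obtain ⟨i, e, he, hve⟩ := hcov v
    obtain ⟨w, rfl⟩ := Sym2.mem_iff_exists.1 hve
    exact ⟨(w, i), he⟩
  choose p hp using hpartner
  have hle := Finset.card_le_card_of_injOn (s := S)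
    (t := nbr G S ×ˢ (Finset.univ : Finset (Fin k))) p
    (by
      intro v hv
      have hadj : G.Adj v (p v).1 := (hM _).1 (hp v)
      simp only [Finset.coe_product, Set.mem_prod, Finset.mem_coe, nbr, Finset.mem_filter,
        Finset.mem_univ, true_and, and_true]
      exact ⟨fun hmem => hS v hv _ hmem hadj, v, hv, hadj⟩)
    (by
      intro u _ v _ huv
      by_contra hne
      have hu := hp u
      rw [huv] at hu
      exact (hM (p v).2).2 hu (hp v) (fun heq => hne (Sym2.congr_left.1 heq)) (p v).1
        ⟨by simp, by simp⟩)
  simpa [mul_comm] using hle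

/-- `s / n` rounded up is at most `k` exactly when `s ≤ k n`. -/
theorem ceil_div_le_iff {s n k : ℕ} (hn : 0 < n) : (s + n - 1) / n ≤ k ↔ s ≤ k * n := by
  rw [← Nat.lt_succ_iff, Nat.div_lt_iff_lt_mul hn, Nat.succ_mul]
  omega

/-- In a connected graph with at least two vertices, nonempty stable sets have neighbors. -/
theorem nbr_card_pos {V : Type*} [Fintype V] [DecidableEq V] (G : SimpleGraph V)
    [DecidableRel G.Adj] (hG : G.Connected) (hV : 2 ≤ Fintype.card V) (S : Finset V)
    (hne : S.Nonempty) (hS : IsStable G S) : 0 < (nbr G S).card := by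
  have : Nontrivial V := Fintype.one_lt_card_iff_nontrivial.1 hV
  obtain ⟨v, hv⟩ := hne
  obtain ⟨w, hvw⟩ := hG.preconnected.exists_adj_of_nontrivial v
  exact Finset.card_pos.2
    ⟨w, by simpa [nbr] using ⟨fun hw => hS v hv w hw hvw, v, hv, hvw⟩⟩

theorem stmt_18 {V : Type*} [Fintype V] [DecidableEq V] (G : SimpleGraph V) [DecidableRel G.Adj]
    (hG : G.Connected) (hV : 2 ≤ Fintype.card V)
    (kmin mx : ℕ)
    (hkmin : kmin = sInf {k : ℕ | ∃ M : Fin k → Finset (Sym2 V),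
      (∀ i, IsMatching G (M i)) ∧ ∀ v : V, ∃ i, Covers (M i) v})
    (hmx : mx = sSup {r : ℕ | ∃ S : Finset V, S.Nonempty ∧ IsStable G S ∧
      r = (S.card + (nbr G S).card - 1) / (nbr G S).card}) :
    (mx ≠ 1 → kmin = mx) ∧
      (mx = 1 →
        ((∃ M : Finset (Sym2 V), IsMatching G M ∧ ∀ v : V, Covers M v) → kmin = 1) ∧
        (¬ (∃ M : Finset (Sym2 V), IsMatching G M ∧ ∀ v : V, Covers M v) → kmin = 2)) := by
  set K := {k : ℕ | ∃ M : Fin k → Finset (Sym2 V),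
    (∀ i, IsMatching G (M i)) ∧ ∀ v : V, ∃ i, Covers (M i) v} with hK
  set R := {r : ℕ | ∃ S : Finset V, S.Nonempty ∧ IsStable G S ∧
    r = (S.card + (nbr G S).card - 1) / (nbr G S).card} with hR
  have hbdd : BddAbove R := by
    refine ⟨Finset.univ.sup fun S : Finset V => (S.card + (nbr G S).card - 1) / (nbr G S).card, ?_⟩
    rintro r ⟨S, -, -, rfl⟩
    exact Finset.le_sup (f := fun S : Finset V =>
      (S.card + (nbr G S).card - 1) / (nbr G S).card) (Finset.mem_univ S)
  have hone : 1 ∈ R := by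
    obtain ⟨v⟩ := hG.nonempty
    have hstable : IsStable G {v} := by simp [IsStable]
    have hpos := nbr_card_pos G hG hV {v} (by simp) hstable
    refine ⟨{v}, by simp, hstable, ?_⟩
    rw [Finset.card_singleton, Nat.add_sub_cancel_left, Nat.div_self hpos]
  have hmx_pos : 1 ≤ mx := hmx ▸ le_csSup hbdd hone
  have hlower : ∀ k ∈ K, mx ≤ k := by
    rintro k ⟨M, hM, hcov⟩
    rw [hmx]
    refine csSup_le ⟨1, hone⟩ ?_
    rintro r ⟨S, hne, hS, rfl⟩
    exact (ceil_div_le_iff (nbr_card_pos G hG hV S hne hS)).2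
      (card_le_of_matchings G k M hM hcov S hS)
  have hupper : ∀ k, 2 ≤ k → mx ≤ k → k ∈ K := by
    intro k hk hmk
    obtain ⟨F, hFG, hcov, hdeg⟩ := exists_edge_cover_degF_le G k hk fun S hS => by
      rcases S.eq_empty_or_nonempty with rfl | hne
      · simp
      · refine (ceil_div_le_iff (nbr_card_pos G hG hV S hne hS)).1 (le_trans ?_ hmk)
        rw [hmx]
        exact le_csSup hbdd ⟨S, hne, hS, rfl⟩
    exact exists_matchings_of_edge_cover G k (by omega) F hFG hcov hdeg
  have hmem : kmin ∈ K := hkmin ▸ Nat.sInf_mem ⟨max mx 2, hupper _ (by simp) (by simp)⟩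
  have hle : ∀ k ∈ K, kmin ≤ k := fun k hk => hkmin ▸ Nat.sInf_le hk
  have hge := hlower kmin hmem
  refine ⟨fun h => le_antisymm (hle mx (hupper mx (by omega) le_rfl)) hge, fun h => ⟨?_, ?_⟩⟩
  · rintro ⟨M, hM, hcov⟩
    have := hle 1 ⟨fun _ => M, fun _ => hM, fun v => ⟨0, hcov v⟩⟩
    omega
  · intro hno
    have h₂ := hle 2 (hupper 2 le_rfl (by omega))
    have h₁ : kmin ≠ 1 := by
      rintro heq
      rw [heq] at hmem
      obtain ⟨M, hM, hcov⟩ := hmem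
      refine hno ⟨M 0, hM 0, fun v => ?_⟩
      obtain ⟨i, hi⟩ := hcov v
      rwa [Subsingleton.elim i 0] at hi
    omega
end
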